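/- (Corollary 1) Fix τ ∈ ℂ with Im τ > 0, set Λ = ℤ + τℤ and q = exp(iπτ). Let α₁ ∉ Λ satisfy ℘(α₁, τ) = 0 and 2α₁ ∉ Λ. Then for every z ∉ Λ, ℘(z, τ) = −π² · (θ₁′(0|τ)² / θ₁(πα₁|τ)²) · θ₁(πz − πα₁|τ) · θ₁(πz + πα₁|τ) / θ₁(πz|τ)². -/

import Mathlib

/-- Jacobi theta function θ₁(z|τ), nome q = exp(iπτ). -/
noncomputable def theta1 (z τ : ℂ) : ℂ :=
  2 * ∑' n : ℕ, (-1) ^ n * Complex.exp (Real.pi * Complex.I * τ * ((n : ℂ) + 1 / 2) ^ 2) *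
      Complex.sin ((2 * (n : ℂ) + 1) * z)

/-- θ₁′(0|τ), the z-derivative of θ₁ at 0. -/
noncomputable def theta1deriv (τ : ℂ) : ℂ :=
  2 * ∑' n : ℕ, (-1) ^ n * (2 * (n : ℂ) + 1) *
      Complex.exp (Real.pi * Complex.I * τ * ((n : ℂ) + 1 / 2) ^ 2)

/-- Weierstrass ℘-function for the lattice ℤ·g₁ + ℤ·g₂. -/
noncomputable def wp (g1 g2 z : ℂ) : ℂ :=
  1 / z ^ 2 + ∑' p : {p : ℤ × ℤ // p ≠ 0},
      (1 / (z - ((p.1.1 : ℂ) * g1 + (p.1.2 : ℂ) * g2)) ^ 2 -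
        1 / ((p.1.1 : ℂ) * g1 + (p.1.2 : ℂ) * g2) ^ 2)

section

open Filter Topology

open Complex in
/-- The integral over a period is invariant under translation of the contour. -/
lemma intervalIntegral_shift_of_periodic {h : ℂ → ℂ} (hd : Differentiable ℂ h)
    (hp : ∀ z, h (z + 1) = h z) (τ : ℂ) :
    ∫ x in (0 : ℝ)..1, h (x + τ) = ∫ x in (0 : ℝ)..1, h x := by
  have hrect := integral_boundary_rect_eq_zero_of_differentiableOn h 0 (1 + τ.im * I)
    hd.differentiableOn
  have hside : ∀ y : ℝ, h (1 + y * I) = h (y * I) := fun y ↦ by rw [add_comm, hp]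
  have hre : Function.Periodic (fun x : ℝ ↦ h (x + τ.im * I)) 1 := fun x ↦ by
    simp only [ofReal_add, ofReal_one]
    rw [← hp (x + τ.im * I)]
    ring_nf
  have hshift := hre.intervalIntegral_add_eq τ.re 0
  have hcomp := intervalIntegral.integral_comp_add_left (fun x : ℝ ↦ h (x + τ.im * I))
    (a := 0) (b := 1) τ.re
  rw [add_zero, hshift, zero_add] at hcomp
  simp [hside] at hrect
  rw [sub_eq_zero.mp hrect, ← hcomp]
  refine intervalIntegral.integral_congr fun x _ ↦ ?_
  congr 1
  conv_lhs => rw [← re_add_im τ]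
  push_cast
  ring

lemma eq_zero_of_integral_exp_eq_zero {f : ℂ → ℂ} (hd : Differentiable ℂ f)
    (hp : ∀ z, f (z + 1) = f z)
    (h0 : ∀ n : ℤ, ∫ x in (0 : ℝ)..1, f x * Complex.exp (-2 * Real.pi * Complex.I * n * x) = 0) :
    ∀ z, f z = 0 := by
  have hper : Function.Periodic (fun x : ℝ ↦ f x) 1 := fun x ↦ by simp [hp]
  have hc : Continuous (fun x : ℝ ↦ f x) := hd.continuous.comp Complex.continuous_ofReal
  let g : C(AddCircle (1 : ℝ), ℂ) := ⟨hper.lift, continuous_quot_lift _ hc⟩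
  have hg : fourierCoeff g = 0 := by
    ext n
    rw [fourierCoeff_eq_intervalIntegral _ n 0]
    simp only [Pi.zero_apply, zero_add, ← h0 n, one_div, inv_one, one_smul]
    refine intervalIntegral.integral_congr fun x _ ↦ ?_
    simp only [fourier_coe_apply, smul_eq_mul]
    rw [mul_comm]
    congr 2
    push_cast
    ring
  have hz : ∀ x : ℝ, f x = 0 := fun x ↦ by
    have := has_pointwise_sum_fourier_series_of_summable (f := g)
      (by rw [hg]; exact summable_zero) x
    simp only [hg, Pi.zero_apply, zero_smul] at this
    exact this.unique hasSum_zero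
  have han : AnalyticOnNhd ℂ f Set.univ := fun z _ ↦ hd.analyticAt z
  have hfreq : ∃ᶠ z in nhdsWithin (0 : ℂ) {0}ᶜ, f z = 0 := by
    have ht : Filter.Tendsto (fun x : ℝ ↦ (x : ℂ)) (nhdsWithin 0 {0}ᶜ) (nhdsWithin 0 {0}ᶜ) := by
      refine tendsto_nhdsWithin_iff.mpr ⟨?_, ?_⟩
      · exact (Complex.continuous_ofReal.tendsto' 0 0 (by simp)).mono_left nhdsWithin_le_nhds
      · filter_upwards [self_mem_nhdsWithin] with x hx
        simpa using hx
    exact ht.frequently (Filter.Eventually.of_forall hz).frequently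
  exact fun z ↦ han.eqOn_zero_of_preconnected_of_frequently_eq_zero isPreconnected_univ
    (Set.mem_univ 0) hfreq (Set.mem_univ z)

/-- Entire functions with the quasi-periodicity of a theta function of degree two. -/
structure IsThetaTwo (τ : ℂ) (f : ℂ → ℂ) : Prop where
  differentiable : Differentiable ℂ f
  add_one : ∀ z, f (z + 1) = f z
  add_tau : ∀ z, f (z + τ) =
    Complex.exp (-2 * Real.pi * Complex.I * τ - 4 * Real.pi * Complex.I * z) * f z

namespace IsThetaTwo

variable {τ : ℂ} {f g h : ℂ → ℂ}

lemma add (hf : IsThetaTwo τ f) (hg : IsThetaTwo τ g) : IsThetaTwo τ (fun z ↦ f z + g z) where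
  differentiable := hf.differentiable.add hg.differentiable
  add_one z := by rw [hf.add_one, hg.add_one]
  add_tau z := by rw [hf.add_tau, hg.add_tau, mul_add]

lemma const_mul (hf : IsThetaTwo τ f) (c : ℂ) : IsThetaTwo τ (fun z ↦ c * f z) where
  differentiable := hf.differentiable.const_mul c
  add_one z := by rw [hf.add_one]
  add_tau z := by rw [hf.add_tau]; ring

/-- The Fourier coefficients along the real period. -/
noncomputable def coeff (f : ℂ → ℂ) (n : ℤ) : ℂ :=
  ∫ x in (0 : ℝ)..1, f x * Complex.exp (-2 * Real.pi * Complex.I * n * x)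

lemma coeff_add_two (hf : IsThetaTwo τ f) (n : ℤ) :
    coeff f n = Complex.exp (-2 * Real.pi * Complex.I * (n + 1) * τ) * coeff f (n + 2) := by
  have hs := intervalIntegral_shift_of_periodic
    (h := fun z ↦ f z * Complex.exp (-2 * Real.pi * Complex.I * n * z))
    (hf.differentiable.mul (by fun_prop)) (fun z ↦ by
      rw [hf.add_one, Complex.exp_eq_exp_iff_exists_int.mpr ⟨-n, ?_⟩]
      push_cast
      ring) τ
  rw [coeff, ← hs, coeff, ← intervalIntegral.integral_const_mul]
  refine intervalIntegral.integral_congr fun x _ ↦ ?_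
  rw [hf.add_tau, mul_right_comm, ← Complex.exp_add, mul_left_comm, ← Complex.exp_add, mul_comm]
  congr 2
  push_cast
  ring

lemma coeff_eq_zero (hf : IsThetaTwo τ f) (h0 : coeff f 0 = 0) (h1 : coeff f 1 = 0) (n : ℤ) :
    coeff f n = 0 := by
  have key : ∀ n, coeff f n = 0 ↔ coeff f (n + 2) = 0 := fun n ↦ by
    rw [hf.coeff_add_two n]; simp [Complex.exp_ne_zero]
  have : ∀ n : ℤ, coeff f n = 0 ∧ coeff f (n + 1) = 0 := fun n ↦ by
    induction n using Int.induction_on with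
    | zero => exact ⟨h0, by simpa using h1⟩
    | succ i ih => exact ⟨ih.2, by rw [add_assoc]; exact (key _).mp ih.1⟩
    | pred i ih =>
      refine ⟨(key _).mpr ?_, by simpa using ih.1⟩
      rw [show -(i : ℤ) - 1 + 2 = -i + 1 by ring]
      exact ih.2
  exact (this n).1

lemma coeff_add (hf : Continuous f) (hg : Continuous g) (n : ℤ) :
    coeff (fun z ↦ f z + g z) n = coeff f n + coeff g n := by
  simp only [coeff, add_mul]
  exact intervalIntegral.integral_add (Continuous.intervalIntegrable (by fun_prop) _ _)
    (Continuous.intervalIntegrable (by fun_prop) _ _)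

lemma coeff_const_mul (c : ℂ) (n : ℤ) : coeff (fun z ↦ c * f z) n = c * coeff f n := by
  simp only [coeff, mul_assoc, intervalIntegral.integral_const_mul]

/-- Theta functions of degree two form a space of dimension at most two. -/
lemma exists_linear_relation (hf : IsThetaTwo τ f) (hg : IsThetaTwo τ g) (hh : IsThetaTwo τ h) :
    ∃ a b c : ℂ, (a ≠ 0 ∨ b ≠ 0 ∨ c ≠ 0) ∧ ∀ z, a * f z + b * g z + c * h z = 0 := by
  let M : Matrix (Fin 2) (Fin 3) ℂ :=
    !![coeff f 0, coeff g 0, coeff h 0; coeff f 1, coeff g 1, coeff h 1]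
  have hker : LinearMap.ker M.mulVecLin ≠ ⊥ :=
    LinearMap.ker_ne_bot_of_finrank_lt (by simp)
  obtain ⟨v, hv, hv0⟩ := (Submodule.ne_bot_iff _).mp hker
  have hcomb := ((hf.const_mul (v 0)).add (hg.const_mul (v 1))).add (hh.const_mul (v 2))
  have hcoef : ∀ n, coeff (fun z ↦ v 0 * f z + v 1 * g z + v 2 * h z) n =
      v 0 * coeff f n + v 1 * coeff g n + v 2 * coeff h n := fun n ↦ by
    have := hf.differentiable.continuous
    have := hg.differentiable.continuous
    have := hh.differentiable.continuous
    rw [coeff_add (by fun_prop) (by fun_prop), coeff_add (by fun_prop) (by fun_prop)]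
    simp only [coeff_const_mul]
  rw [LinearMap.mem_ker] at hv
  have e0 := congrFun hv 0
  have e1 := congrFun hv 1
  simp [M, Matrix.mulVec, dotProduct, Fin.sum_univ_three] at e0 e1
  refine ⟨v 0, v 1, v 2, ?_, eq_zero_of_integral_exp_eq_zero hcomb.differentiable hcomb.add_one
    (hcomb.coeff_eq_zero ?_ ?_)⟩
  · by_contra! hc
    exact hv0 (by ext i; fin_cases i <;> simp [hc])
  · rw [hcoef]; linear_combination e0
  · rw [hcoef]; linear_combination e1

end IsThetaTwo

open Complex in
lemma exp_mul_jacobiTheta₂_term_half_period (m : ℤ) (z τ : ℂ) :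
    exp (Real.pi * I * τ / 4 + Real.pi * I * z) * jacobiTheta₂_term m (z + 1 / 2 + τ / 2) τ =
      (-1) ^ m * exp (Real.pi * I * τ * ((m : ℂ) + 1 / 2) ^ 2) *
        exp ((2 * m + 1) * (Real.pi * z) * I) := by
  rw [← exp_pi_mul_I, ← exp_int_mul, jacobiTheta₂_term, ← exp_add, ← exp_add, ← exp_add]
  congr 1
  ring

open Complex in
lemma exp_mul_jacobiTheta₂_term_half_period_neg (n : ℕ) (z τ : ℂ) :
    exp (Real.pi * I * τ / 4 + Real.pi * I * z) *
        jacobiTheta₂_term (-(n + 1)) (z + 1 / 2 + τ / 2) τ =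
      -((-1) ^ n * exp (Real.pi * I * τ * ((n : ℂ) + 1 / 2) ^ 2) *
        exp (-((2 * n + 1) * (Real.pi * z)) * I)) := by
  rw [exp_mul_jacobiTheta₂_term_half_period]
  have h1 : ((-1 : ℂ)) ^ (-((n : ℤ) + 1)) = -(-1) ^ n := by
    rw [zpow_neg, ← inv_zpow, inv_neg, inv_one, ← Nat.cast_succ, zpow_natCast, pow_succ]
    ring
  rw [h1]
  push_cast
  rw [show (-((n : ℂ) + 1) + 1 / 2) ^ 2 = (n + 1 / 2) ^ 2 by ring,
    show (2 * -((n : ℂ) + 1) + 1) = -(2 * n + 1) by ring]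
  ring_nf

open Complex in
lemma theta1_pi_mul_eq {τ : ℂ} (hτ : 0 < τ.im) (z : ℂ) :
    theta1 (Real.pi * z) τ = -I * (exp (Real.pi * I * τ / 4 + Real.pi * I * z) *
      jacobiTheta₂ (z + 1 / 2 + τ / 2) τ) := by
  have hs := (((hasSum_jacobiTheta₂_term (z + 1 / 2 + τ / 2) hτ).mul_left
    (exp (Real.pi * I * τ / 4 + Real.pi * I * z))).mul_left (-I)).nat_add_neg_add_one
  rw [← hs.tsum_eq, theta1, ← tsum_mul_left]
  refine tsum_congr fun n ↦ ?_
  rw [exp_mul_jacobiTheta₂_term_half_period_neg, exp_mul_jacobiTheta₂_term_half_period, sin]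
  push_cast
  rw [zpow_natCast]
  ring

open Complex in
lemma hasDerivAt_theta1_pi_mul {τ : ℂ} (hτ : 0 < τ.im) (z : ℂ) :
    HasDerivAt (fun z ↦ theta1 (Real.pi * z) τ)
      (-I * (exp (Real.pi * I * τ / 4 + Real.pi * I * z) * (Real.pi * I) *
        jacobiTheta₂ (z + 1 / 2 + τ / 2) τ +
        exp (Real.pi * I * τ / 4 + Real.pi * I * z) *
          jacobiTheta₂' (z + 1 / 2 + τ / 2) τ)) z := by
  rw [funext (theta1_pi_mul_eq hτ)]
  have h1 : HasDerivAt (fun z ↦ exp (Real.pi * I * τ / 4 + Real.pi * I * z))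
      (exp (Real.pi * I * τ / 4 + Real.pi * I * z) * (Real.pi * I)) z := by
    simpa using (((hasDerivAt_id z).const_mul (Real.pi * I)).const_add (Real.pi * I * τ / 4)).cexp
  have h2 : HasDerivAt (fun z ↦ jacobiTheta₂ (z + 1 / 2 + τ / 2) τ)
      (jacobiTheta₂' (z + 1 / 2 + τ / 2) τ) z := by
    simpa [add_assoc] using
      (hasDerivAt_jacobiTheta₂_fst (z + (1 / 2 + τ / 2)) hτ).comp_add_const z (1 / 2 + τ / 2)
  exact (h1.mul h2).const_mul _

open Complex in
lemma deriv_theta1_pi_mul_zero {τ : ℂ} (hτ : 0 < τ.im) :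
    deriv (fun z ↦ theta1 (Real.pi * z) τ) 0 = Real.pi * theta1deriv τ := by
  rw [(hasDerivAt_theta1_pi_mul hτ 0).deriv]
  have hs := ((((hasSum_jacobiTheta₂_term (0 + 1 / 2 + τ / 2) hτ).mul_left
    (exp (Real.pi * I * τ / 4 + Real.pi * I * 0) * (Real.pi * I))).add
    ((hasSum_jacobiTheta₂'_term (0 + 1 / 2 + τ / 2) hτ).mul_left
      (exp (Real.pi * I * τ / 4 + Real.pi * I * 0)))).mul_left (-I)).nat_add_neg_add_one
  rw [← hs.tsum_eq, theta1deriv, ← tsum_mul_left, ← tsum_mul_left]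
  refine tsum_congr fun n ↦ ?_
  have e1 := exp_mul_jacobiTheta₂_term_half_period n 0 τ
  have e2 := exp_mul_jacobiTheta₂_term_half_period_neg n 0 τ
  simp only [zpow_natCast, mul_zero, neg_zero, zero_mul, exp_zero, mul_one, Int.cast_natCast,
    add_zero] at e1 e2
  simp only [jacobiTheta₂'_term, mul_zero, add_zero]
  push_cast
  linear_combination (-I * Real.pi * I * (2 * n + 1)) * e1 +
    (I * Real.pi * I * (2 * n + 1)) * e2 - Real.pi * 2 * (-1) ^ n * (2 * n + 1) *
      exp (Real.pi * I * τ * ((n : ℂ) + 1 / 2) ^ 2) * I_sq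

lemma differentiable_theta1_pi_mul {τ : ℂ} (hτ : 0 < τ.im) :
    Differentiable ℂ (fun z ↦ theta1 (Real.pi * z) τ) :=
  fun z ↦ (hasDerivAt_theta1_pi_mul hτ z).differentiableAt

lemma theta1_neg (z τ : ℂ) : theta1 (-z) τ = -theta1 z τ := by
  simp only [theta1, mul_neg, Complex.sin_neg, tsum_neg]

lemma theta1_zero (τ : ℂ) : theta1 0 τ = 0 := by
  simp [theta1]

open Complex in
lemma theta1_pi_mul_add_one {τ : ℂ} (hτ : 0 < τ.im) (z : ℂ) :
    theta1 (Real.pi * (z + 1)) τ = -theta1 (Real.pi * z) τ := by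
  rw [theta1_pi_mul_eq hτ, theta1_pi_mul_eq hτ,
    show z + 1 + 1 / 2 + τ / 2 = z + 1 / 2 + τ / 2 + 1 by ring, jacobiTheta₂_add_left,
    show Real.pi * I * τ / 4 + Real.pi * I * (z + 1) =
      Real.pi * I * τ / 4 + Real.pi * I * z + Real.pi * I by ring, exp_add _ (Real.pi * I),
    exp_pi_mul_I]
  ring

open Complex in
lemma theta1_pi_mul_add_tau {τ : ℂ} (hτ : 0 < τ.im) (z : ℂ) :
    theta1 (Real.pi * (z + τ)) τ =
      -exp (-Real.pi * I * τ - 2 * Real.pi * I * z) * theta1 (Real.pi * z) τ := by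
  rw [theta1_pi_mul_eq hτ, theta1_pi_mul_eq hτ,
    show z + τ + 1 / 2 + τ / 2 = z + 1 / 2 + τ / 2 + τ by ring, jacobiTheta₂_add_left',
    show Real.pi * I * τ / 4 + Real.pi * I * (z + τ) =
      Real.pi * I * τ / 4 + Real.pi * I * z + Real.pi * I * τ by ring,
    show -Real.pi * I * (τ + 2 * (z + 1 / 2 + τ / 2)) =
      (-Real.pi * I * τ - 2 * Real.pi * I * z) - Real.pi * I * τ - Real.pi * I by ring,
    exp_add _ (Real.pi * I * τ), exp_sub _ (Real.pi * I), exp_sub _ (Real.pi * I * τ),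
    exp_pi_mul_I]
  field_simp [exp_ne_zero]

open Complex in
lemma integral_jacobiTheta₂ {τ : ℂ} (hτ : 0 < τ.im) :
    ∫ x in (0 : ℝ)..1, jacobiTheta₂ x τ = 1 := by
  let f : ℤ → C(ℝ, ℂ) := fun n ↦
    ⟨fun x ↦ jacobiTheta₂_term n x τ, by unfold jacobiTheta₂_term; fun_prop⟩
  have hf : Summable fun n ↦
      ‖(f n).restrict (⟨Set.uIcc 0 1, isCompact_uIcc⟩ : TopologicalSpace.Compacts ℝ)‖ := by
    refine Summable.of_nonneg_of_le (fun _ ↦ norm_nonneg _) (fun n ↦ ?_)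
      ((summable_jacobiTheta₂_term_iff 0 τ).mpr hτ).norm
    refine (ContinuousMap.norm_le _ (norm_nonneg _)).mpr fun x ↦ ?_
    simp [f, norm_jacobiTheta₂_term]
  have hs := intervalIntegral.hasSum_intervalIntegral_of_summable_norm hf
  refine hs.unique ?_
  convert! hasSum_ite_eq (0 : ℤ) (1 : ℂ) using 1
  ext n
  simp only [f, ContinuousMap.coe_mk, jacobiTheta₂_term]
  split_ifs with hn
  · simp [hn]
  · simp_rw [exp_add]
    rw [intervalIntegral.integral_mul_const, integral_exp_mul_complex]
    · have := exp_int_mul_two_pi_mul_I n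
      rw [mul_comm] at this
      simp [this]
    · simp [hn, Real.pi_ne_zero]

lemma exists_theta1_pi_mul_ne_zero {τ : ℂ} (hτ : 0 < τ.im) : ∃ z, theta1 (Real.pi * z) τ ≠ 0 := by
  by_contra! h
  have h0 : ∀ z, jacobiTheta₂ z τ = 0 := fun z ↦ by
    have := h (z - 1 / 2 - τ / 2)
    rw [theta1_pi_mul_eq hτ, show z - 1 / 2 - τ / 2 + 1 / 2 + τ / 2 = z by ring] at this
    simpa [Complex.exp_ne_zero] using this
  simpa [h0] using integral_jacobiTheta₂ hτ

/-- The period pair `(1, τ)`. -/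
noncomputable def periodPairOfTau (τ : ℂ) (hτ : 0 < τ.im) : PeriodPair where
  ω₁ := 1
  ω₂ := τ
  indep := by
    refine LinearIndependent.pair_iff.mpr fun s t h ↦ ?_
    have him := congrArg Complex.im h
    have hre := congrArg Complex.re h
    simp [hτ.ne'] at him hre
    subst him
    simpa using hre

lemma mem_lattice_periodPairOfTau {τ : ℂ} (hτ : 0 < τ.im) {x : ℂ} :
    x ∈ (periodPairOfTau τ hτ).lattice ↔ ∃ m n : ℤ, x = m + n * τ := by
  simp [PeriodPair.mem_lattice, periodPairOfTau, eq_comm]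

lemma wp_eq_weierstrassP {τ : ℂ} (hτ : 0 < τ.im) (z : ℂ) :
    wp 1 τ z = (periodPairOfTau τ hτ).weierstrassP z := by
  set L := periodPairOfTau τ hτ with hL
  have hs := (L.latticeEquivProd.symm.toEquiv.hasSum_iff).mpr (L.hasSum_weierstrassP z)
  rw [← hs.tsum_eq, hs.summable.tsum_eq_add_tsum_ite 0, wp, ← tsum_subtype_eq_of_support_subset
    (s := {p : ℤ × ℤ | p ≠ 0})]
  · congr 1
    · simp
    · refine tsum_congr fun p ↦ ?_
      have hp : p.1 ≠ 0 := p.2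
      simp [hp, PeriodPair.latticeEquiv_symm_apply, hL, periodPairOfTau]
  · intro p hp h0
    simp [h0] at hp

namespace PeriodPair

variable (L : PeriodPair)

lemma countable_lattice : (L.lattice : Set ℂ).Countable :=
  countable_of_Lindelof_of_discrete (X := L.lattice)

lemma eventually_notMem_lattice : ∀ᶠ z in 𝓝[≠] (0 : ℂ), z ∉ L.lattice := by
  filter_upwards [nhdsWithin_le_nhds (L.compl_lattice_sdiff_singleton_mem_nhds 0),
    self_mem_nhdsWithin] with z hz hz0 hzL
  exact hz ⟨hzL, hz0⟩

lemma tendsto_sq_mul_weierstrassP :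
    Tendsto (fun z ↦ z ^ 2 * L.weierstrassP z) (𝓝[≠] 0) (𝓝 1) := by
  have hc : ContinuousAt (fun z ↦ z ^ 2 * L.weierstrassPExcept 0 z + 1) 0 :=
    ((continuousAt_id.pow 2).mul (L.analyticAt_weierstrassPExcept 0).continuousAt).add
      continuousAt_const
  have ht : Tendsto (fun z ↦ z ^ 2 * L.weierstrassPExcept 0 z + 1) (𝓝[≠] 0) (𝓝 1) := by
    simpa using hc.tendsto.mono_left nhdsWithin_le_nhds
  refine ht.congr' ?_
  filter_upwards [self_mem_nhdsWithin] with z hz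
  have hz : z ≠ 0 := hz
  have := L.weierstrassPExcept_add (0 : L.lattice) z
  simp only [ZeroMemClass.coe_zero, sub_zero] at this
  rw [← this]
  field_simp
  simp

lemma eq_zero_of_eventually_add_mul_weierstrassP {g : ℂ → ℂ} {b : ℂ}
    (hg : ContinuousAt g 0) (h : ∀ᶠ z in 𝓝[≠] 0, g z + b * L.weierstrassP z = 0) : b = 0 := by
  have h1 : Tendsto (fun z : ℂ ↦ z ^ 2 * g z) (𝓝[≠] 0) (𝓝 0) := by
    have hc : ContinuousAt (fun z : ℂ ↦ z ^ 2 * g z) 0 := (continuousAt_id.pow 2).mul hg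
    simpa using hc.tendsto.mono_left nhdsWithin_le_nhds
  have h2 := h1.add (L.tendsto_sq_mul_weierstrassP.const_mul b)
  have h3 : Tendsto (fun z ↦ z ^ 2 * g z + b * (z ^ 2 * L.weierstrassP z)) (𝓝[≠] 0) (𝓝 0) := by
    refine tendsto_const_nhds.congr' ?_
    filter_upwards [h] with z hz
    linear_combination -z ^ 2 * hz
  simpa using tendsto_nhds_unique h2 h3

lemma continuousAt_weierstrassP {z : ℂ} (hz : z ∉ L.lattice) : ContinuousAt L.weierstrassP z :=
  (L.differentiableOn_weierstrassP.differentiableAt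
    (L.isClosed_lattice.isOpen_compl.mem_nhds hz)).continuousAt

end PeriodPair

/-- `f` is divisible by `(x - z) ^ k` in the ring of entire functions. -/
def VanishesToOrder (k : ℕ) (f : ℂ → ℂ) (z : ℂ) : Prop :=
  ∃ Q : ℂ → ℂ, Differentiable ℂ Q ∧ ∀ x, f x = (x - z) ^ k * Q x

lemma Differentiable.dslope {f : ℂ → ℂ} (hf : Differentiable ℂ f) (z : ℂ) :
    Differentiable ℂ (dslope f z) :=
  differentiableOn_univ.mp ((Complex.differentiableOn_dslope univ_mem).mpr hf.differentiableOn)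

namespace VanishesToOrder

variable {f : ℂ → ℂ} {z : ℂ}

lemma of_eq_zero (hf : Differentiable ℂ f) (h : f z = 0) : VanishesToOrder 1 f z := by
  refine ⟨dslope f z, hf.dslope z, fun x ↦ ?_⟩
  have := sub_smul_dslope f z x
  simp_all

lemma of_deriv_eq_zero (hf : Differentiable ℂ f) (h : f z = 0) (h' : deriv f z = 0) :
    VanishesToOrder 2 f z := by
  obtain ⟨Q, hQ, hQ'⟩ := of_eq_zero (hf.dslope z) (z := z) (by simpa using h')
  refine ⟨Q, hQ, fun x ↦ ?_⟩
  have := sub_smul_dslope f z x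
  simp only [smul_eq_mul, h, sub_zero] at this
  rw [← this, hQ']
  ring

lemma sq (h : VanishesToOrder 1 f z) : VanishesToOrder 2 (fun x ↦ f x ^ 2) z := by
  obtain ⟨Q, hQ, hQ'⟩ := h
  exact ⟨fun x ↦ Q x ^ 2, hQ.pow 2, fun x ↦ by simp only [hQ' x]; ring⟩

lemma add_iff {e : ℂ → ℂ} {s : ℂ} (he : Differentiable ℂ e) (he0 : ∀ x, e x ≠ 0)
    (hf : ∀ x, f (x + s) = e x * f x) (k : ℕ) :
    VanishesToOrder k f (z + s) ↔ VanishesToOrder k f z := by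
  constructor
  · rintro ⟨Q, hQ, hQ'⟩
    refine ⟨fun x ↦ (e x)⁻¹ * Q (x + s), (he.inv he0).mul (hQ.comp (by fun_prop)), fun x ↦ ?_⟩
    rw [← inv_mul_cancel_left₀ (he0 x) (f x), ← hf, hQ']
    ring
  · rintro ⟨Q, hQ, hQ'⟩
    refine ⟨fun x ↦ e (x - s) * Q (x - s), (he.comp (by fun_prop)).mul (hQ.comp (by fun_prop)),
      fun x ↦ ?_⟩
    rw [← sub_add_cancel x s, hf, hQ']
    ring_nf

end VanishesToOrder

lemma vanishesToOrder_theta1_add {τ : ℂ} (hτ : 0 < τ.im) (k : ℕ) {w : ℂ}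
    (h : VanishesToOrder k (fun z ↦ theta1 (Real.pi * z) τ) w) (m n : ℤ) :
    VanishesToOrder k (fun z ↦ theta1 (Real.pi * z) τ) (w + (m + n * τ)) := by
  have h1 : ∀ z, VanishesToOrder k (fun z ↦ theta1 (Real.pi * z) τ) (z + 1) ↔
      VanishesToOrder k (fun z ↦ theta1 (Real.pi * z) τ) z := fun z ↦
    VanishesToOrder.add_iff (e := fun _ ↦ -1) (by fun_prop) (by simp)
      (by simpa using theta1_pi_mul_add_one hτ) k
  have h2 : ∀ z, VanishesToOrder k (fun z ↦ theta1 (Real.pi * z) τ) (z + τ) ↔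
      VanishesToOrder k (fun z ↦ theta1 (Real.pi * z) τ) z := fun z ↦
    VanishesToOrder.add_iff
      (e := fun x ↦ -Complex.exp (-Real.pi * Complex.I * τ - 2 * Real.pi * Complex.I * x))
      (by fun_prop) (by simp [Complex.exp_ne_zero]) (theta1_pi_mul_add_tau hτ) k
  have h3 : VanishesToOrder k (fun z ↦ theta1 (Real.pi * z) τ) (w + m) := by
    induction m using Int.induction_on with
    | zero => simpa using h
    | succ i ih => simpa [add_assoc] using (h1 _).mpr ih
    | pred i ih =>
      rw [← h1]
      convert ih using 1
      push_cast
      ring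
  induction n using Int.induction_on with
  | zero => simpa using h3
  | succ i ih =>
    convert (h2 _).mpr ih using 1
    push_cast
    ring
  | pred i ih =>
    rw [← h2]
    convert ih using 1
    push_cast
    ring

/-- The product of `℘(z - w)` with an entire function vanishing doubly at its poles is entire. -/
lemma PeriodPair.exists_entire_mul_weierstrassP (L : PeriodPair) (w : ℂ) {P : ℂ → ℂ}
    (hP : ∀ l ∈ L.lattice, VanishesToOrder 2 P (w + l)) (hPd : Differentiable ℂ P) :
    ∃ E : ℂ → ℂ, Differentiable ℂ E ∧
      ∀ z, z - w ∉ L.lattice → E z = P z * L.weierstrassP (z - w) := by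
  classical
  choose! Q hQ hQ' using hP
  refine ⟨fun z ↦ if z - w ∈ L.lattice then Q (z - w) z else P z * L.weierstrassP (z - w),
    fun z ↦ ?_, fun z hz ↦ if_neg hz⟩
  by_cases hz : z - w ∈ L.lattice
  · set l : ℂ := z - w with hl
    have hopen : ∀ᶠ x in 𝓝 z, x - w ∉ (L.lattice : Set ℂ) \ {l} := by
      have hc : ContinuousAt (fun x ↦ x - w) z := by fun_prop
      exact hc.eventually_mem (L.compl_lattice_sdiff_singleton_mem_nhds (z - w))
    have heq : (fun x ↦ if x - w ∈ L.lattice then Q (x - w) x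
        else P x * L.weierstrassP (x - w)) =ᶠ[𝓝 z]
        fun x ↦ Q l x + P x * (L.weierstrassPExcept l (x - w) - 1 / l ^ 2) := by
      filter_upwards [hopen] with x hx
      by_cases hxz : x = z
      · subst hxz
        rw [if_pos hz, hQ' l hz x, hl]
        ring
      · have hxl : x - w ≠ l := fun h ↦ hxz (by linear_combination h + hl)
        have hx' : x - w ∉ L.lattice := fun h ↦ hx ⟨h, hxl⟩
        have hne : x - (w + l) ≠ 0 := fun h ↦ hxl (by linear_combination h)
        rw [if_neg hx', ← L.weierstrassPExcept_add ⟨l, hz⟩ (x - w), hQ' l hz x]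
        have : x - w - l = x - (w + l) := by ring
        simp only [this]
        field_simp
        ring
    refine DifferentiableAt.congr_of_eventuallyEq ?_ heq
    have hE : DifferentiableAt ℂ (fun x ↦ L.weierstrassPExcept l (x - w)) z :=
      (L.analyticAt_weierstrassPExcept l).differentiableAt.comp z
        (f := fun x ↦ x - w) (by fun_prop)
    exact (hQ l hz z).add ((hPd z).mul (hE.sub_const _))
  · have hopen : ∀ᶠ x in 𝓝 z, x - w ∉ L.lattice := by
      have hc : ContinuousAt (fun x ↦ x - w) z := by fun_prop
      exact hc.eventually_mem (L.isClosed_lattice.isOpen_compl.mem_nhds hz)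
    have heq : (fun x ↦ if x - w ∈ L.lattice then Q (x - w) x
        else P x * L.weierstrassP (x - w)) =ᶠ[𝓝 z] fun x ↦ P x * L.weierstrassP (x - w) := by
      filter_upwards [hopen] with x hx
      rw [if_neg hx]
    refine DifferentiableAt.congr_of_eventuallyEq ?_ heq
    exact (hPd z).mul ((L.differentiableOn_weierstrassP.differentiableAt
      (L.isClosed_lattice.isOpen_compl.mem_nhds hz)).comp z (f := fun x ↦ x - w) (by fun_prop))

lemma IsThetaTwo.of_countable {τ : ℂ} {E : ℂ → ℂ} {s : Set ℂ} (hE : Differentiable ℂ E)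
    (hs : s.Countable) (h1 : ∀ z ∉ s, E (z + 1) = E z)
    (h2 : ∀ z ∉ s, E (z + τ) =
      Complex.exp (-2 * Real.pi * Complex.I * τ - 4 * Real.pi * Complex.I * z) * E z) :
    IsThetaTwo τ E := by
  have hc := hE.continuous
  exact ⟨hE, congrFun (Continuous.ext_on (hs.dense_compl ℝ) (by fun_prop) hc h1),
    congrFun (Continuous.ext_on (hs.dense_compl ℝ) (by fun_prop) (by fun_prop) h2)⟩

lemma IsThetaTwo.of_eq_mul_weierstrassP {τ : ℂ} (hτ : 0 < τ.im) {P E : ℂ → ℂ}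
    (hP : IsThetaTwo τ P)
    (hE : Differentiable ℂ E) (w : ℂ)
    (h : ∀ z, z - w ∉ (periodPairOfTau τ hτ).lattice →
      E z = P z * (periodPairOfTau τ hτ).weierstrassP (z - w)) : IsThetaTwo τ E := by
  set L := periodPairOfTau τ hτ
  have key : ∀ l ∈ L.lattice, ∀ z, z - w ∉ L.lattice →
      E (z + l) = P (z + l) * L.weierstrassP (z - w) := fun l hl z hz ↦ by
    have he : z + l - w = z - w + (⟨l, hl⟩ : L.lattice) := by push_cast; ring
    rw [h, he, L.weierstrassP_add_coe]
    rw [he]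
    exact fun h' ↦ hz (by simpa using L.lattice.sub_mem h' hl)
  refine of_countable (s := {z | z - w ∈ L.lattice}) hE ?_ (fun z hz ↦ ?_) (fun z hz ↦ ?_)
  · exact L.countable_lattice.preimage (sub_left_injective)
  · rw [key 1 L.ω₁_mem_lattice z hz, h z hz, hP.add_one]
  · rw [key τ L.ω₂_mem_lattice z hz, h z hz, hP.add_tau, mul_assoc]

lemma IsThetaTwo.theta1_mul_theta1 {τ : ℂ} (hτ : 0 < τ.im) (α : ℂ) :
    IsThetaTwo τ (fun z ↦ theta1 (Real.pi * (z - α)) τ * theta1 (Real.pi * (z + α)) τ) where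
  differentiable := ((differentiable_theta1_pi_mul hτ).comp (by fun_prop)).mul
    ((differentiable_theta1_pi_mul hτ).comp (by fun_prop))
  add_one z := by
    rw [add_sub_right_comm, add_right_comm, theta1_pi_mul_add_one hτ, theta1_pi_mul_add_one hτ]
    ring
  add_tau z := by
    rw [add_sub_right_comm, add_right_comm, theta1_pi_mul_add_tau hτ, theta1_pi_mul_add_tau hτ,
      show -2 * Real.pi * Complex.I * τ - 4 * Real.pi * Complex.I * z =
        (-Real.pi * Complex.I * τ - 2 * Real.pi * Complex.I * (z - α)) +
        (-Real.pi * Complex.I * τ - 2 * Real.pi * Complex.I * (z + α)) by ring, Complex.exp_add]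
    ring

lemma IsThetaTwo.theta1_sq {τ : ℂ} (hτ : 0 < τ.im) :
    IsThetaTwo τ (fun z ↦ theta1 (Real.pi * z) τ ^ 2) := by
  simpa [sq] using theta1_mul_theta1 hτ 0

lemma eventually_theta1_pi_mul_ne_zero {τ : ℂ} (hτ : 0 < τ.im) (w : ℂ) :
    ∀ᶠ z in 𝓝[≠] w, theta1 (Real.pi * z) τ ≠ 0 := by
  have hd := differentiable_theta1_pi_mul hτ
  refine (hd.analyticAt w).eventually_eq_zero_or_eventually_ne_zero.resolve_left fun h ↦ ?_
  obtain ⟨z, hz⟩ := exists_theta1_pi_mul_ne_zero hτ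
  have han : AnalyticOnNhd ℂ (fun z ↦ theta1 (Real.pi * z) τ) Set.univ :=
    fun z _ ↦ hd.analyticAt z
  exact hz (han.eqOn_zero_of_preconnected_of_eventuallyEq_zero isPreconnected_univ
    (Set.mem_univ w) h (Set.mem_univ z))

lemma vanishesToOrder_theta1_of_mem {τ : ℂ} (hτ : 0 < τ.im) {k : ℕ} {w l : ℂ}
    (h : VanishesToOrder k (fun z ↦ theta1 (Real.pi * z) τ) w)
    (hl : l ∈ (periodPairOfTau τ hτ).lattice) :
    VanishesToOrder k (fun z ↦ theta1 (Real.pi * z) τ) (w + l) := by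
  obtain ⟨m, n, rfl⟩ := (mem_lattice_periodPairOfTau hτ).mp hl
  exact vanishesToOrder_theta1_add hτ k h m n

lemma exists_isThetaTwo_eq_theta1_sq_mul_weierstrassP {τ : ℂ} (hτ : 0 < τ.im) {w : ℂ}
    (hw : theta1 (Real.pi * w) τ = 0) :
    ∃ E, IsThetaTwo τ E ∧ ∀ z, z - w ∉ (periodPairOfTau τ hτ).lattice →
      E z = theta1 (Real.pi * z) τ ^ 2 * (periodPairOfTau τ hτ).weierstrassP (z - w) := by
  have hF := differentiable_theta1_pi_mul hτ
  obtain ⟨E, hE, hE'⟩ := (periodPairOfTau τ hτ).exists_entire_mul_weierstrassP w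
    (P := fun z ↦ theta1 (Real.pi * z) τ ^ 2)
    (fun l hl ↦ (vanishesToOrder_theta1_of_mem hτ (.of_eq_zero hF hw) hl).sq) (hF.pow 2)
  exact ⟨E, (IsThetaTwo.theta1_sq hτ).of_eq_mul_weierstrassP hτ hE w hE', hE'⟩

lemma theta1deriv_ne_zero {τ : ℂ} (hτ : 0 < τ.im) : theta1deriv τ ≠ 0 := by
  intro hc
  set L := periodPairOfTau τ hτ with hL
  have hF := differentiable_theta1_pi_mul hτ
  have h2 : VanishesToOrder 2 (fun z ↦ theta1 (Real.pi * z) τ) 0 :=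
    .of_deriv_eq_zero hF (by simp [theta1_zero]) (by rw [deriv_theta1_pi_mul_zero hτ, hc, mul_zero])
  have h2' := fun l hl ↦ vanishesToOrder_theta1_of_mem (l := l) hτ h2 hl
  obtain ⟨E, hE, hE'⟩ := L.exists_entire_mul_weierstrassP 0 h2' hF
  have hFE : IsThetaTwo τ (fun z ↦ theta1 (Real.pi * z) τ * E z) :=
    (IsThetaTwo.theta1_sq hτ).of_eq_mul_weierstrassP hτ (hF.mul hE) 0
      fun z hz ↦ by rw [hE' z hz]; ring
  obtain ⟨G, hG, hG'⟩ := L.exists_entire_mul_weierstrassP 0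
    (P := fun z ↦ theta1 (Real.pi * z) τ * E z) (fun l hl ↦ by
      obtain ⟨Q, hQ, hQ'⟩ := h2' l hl
      exact ⟨fun z ↦ Q z * E z, hQ.mul hE, fun z ↦ by simp only [hQ' z]; ring⟩) (hF.mul hE)
  obtain ⟨a, b, c, hne, hrel⟩ := IsThetaTwo.exists_linear_relation (IsThetaTwo.theta1_sq hτ) hFE
    (hFE.of_eq_mul_weierstrassP hτ hG 0 hG')
  have hev : ∀ᶠ z in 𝓝[≠] 0, a + b * L.weierstrassP z + c * L.weierstrassP z ^ 2 = 0 := by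
    filter_upwards [L.eventually_notMem_lattice, eventually_theta1_pi_mul_ne_zero hτ 0]
      with z hz hFz
    have hz' : z - 0 ∉ L.lattice := by simpa using hz
    have := hrel z
    rw [hG' z hz', hE' z hz', sub_zero] at this
    refine (mul_eq_zero.mp (?_ : theta1 (Real.pi * z) τ ^ 2 * _ = 0)).resolve_left
      (pow_ne_zero 2 hFz)
    linear_combination this
  have hc0 : c = 0 := by
    have h1 := L.tendsto_sq_mul_weierstrassP
    have h0 : Tendsto (fun z : ℂ ↦ z) (𝓝[≠] 0) (𝓝 0) := tendsto_id.mono_left nhdsWithin_le_nhds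
    have h3 := (((h0.pow 4).const_mul a).add (((h0.pow 2).mul h1).const_mul b)).add
      ((h1.pow 2).const_mul c)
    have h4 := h3.congr' (f₂ := fun _ ↦ (0 : ℂ)) (by
      filter_upwards [hev] with z hz
      linear_combination z ^ 4 * hz)
    simpa using tendsto_nhds_unique h4 tendsto_const_nhds
  have hb0 : b = 0 := L.eq_zero_of_eventually_add_mul_weierstrassP (g := fun _ ↦ a)
    continuousAt_const (by simpa [hc0] using hev)
  have ha0 : a = 0 := by simpa [hc0, hb0] using hev
  simp [ha0, hb0, hc0] at hne

lemma theta1_pi_mul_ne_zero {τ : ℂ} (hτ : 0 < τ.im) {w : ℂ}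
    (hw : w ∉ (periodPairOfTau τ hτ).lattice) :
    theta1 (Real.pi * w) τ ≠ 0 := by
  intro h0
  set L := periodPairOfTau τ hτ with hL
  obtain ⟨E, hE, hE'⟩ := exists_isThetaTwo_eq_theta1_sq_mul_weierstrassP hτ (w := 0)
    (by simp [theta1_zero])
  obtain ⟨G, hG, hG'⟩ := exists_isThetaTwo_eq_theta1_sq_mul_weierstrassP hτ h0
  obtain ⟨a, b, c, hne, hrel⟩ := IsThetaTwo.exists_linear_relation (IsThetaTwo.theta1_sq hτ) hE hG
  have key : ∀ z, theta1 (Real.pi * z) τ ≠ 0 → z ∉ L.lattice → z - w ∉ L.lattice →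
      a + b * L.weierstrassP z + c * L.weierstrassP (z - w) = 0 := fun z hFz hz hzw ↦ by
    have := hrel z
    rw [hE' z (by simpa using hz), hG' z hzw, sub_zero] at this
    refine (mul_eq_zero.mp (?_ : theta1 (Real.pi * z) τ ^ 2 * _ = 0)).resolve_left
      (pow_ne_zero 2 hFz)
    linear_combination this
  have hev : ∀ᶠ z in 𝓝[≠] 0, a + c * L.weierstrassP (z - w) + b * L.weierstrassP z = 0 := by
    have hc : ContinuousAt (fun z ↦ z - w) 0 := by fun_prop
    filter_upwards [L.eventually_notMem_lattice, eventually_theta1_pi_mul_ne_zero hτ 0,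
      nhdsWithin_le_nhds (hc.eventually_mem (L.isClosed_lattice.isOpen_compl.mem_nhds
        (by simpa using hw)))] with z hz hFz hzw
    linear_combination key z hFz hz hzw
  have hb0 : b = 0 := L.eq_zero_of_eventually_add_mul_weierstrassP
    (g := fun z ↦ a + c * L.weierstrassP (z - w))
    (continuousAt_const.add (continuousAt_const.mul (ContinuousAt.comp (f := fun z ↦ z - w)
      (L.continuousAt_weierstrassP (by simpa using hw)) (by fun_prop)))) hev
  have hev' : ∀ᶠ u in 𝓝[≠] 0, a + c * L.weierstrassP u = 0 := by
    have hc : ContinuousAt (fun u ↦ u + w) 0 := by fun_prop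
    have ht : Tendsto (fun u ↦ u + w) (𝓝[≠] 0) (𝓝[≠] w) :=
      tendsto_nhdsWithin_iff.mpr ⟨by simpa using hc.tendsto.mono_left nhdsWithin_le_nhds, by
        filter_upwards [self_mem_nhdsWithin] with u hu
        simpa using hu⟩
    filter_upwards [L.eventually_notMem_lattice,
      ht.eventually (eventually_theta1_pi_mul_ne_zero hτ w),
      nhdsWithin_le_nhds (hc.eventually_mem (L.isClosed_lattice.isOpen_compl.mem_nhds
        (by simpa using hw)))] with u hu hFu huw
    simpa [hb0] using key (u + w) hFu huw (by simpa using hu)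
  have hc0 : c = 0 := L.eq_zero_of_eventually_add_mul_weierstrassP (g := fun _ ↦ a)
    continuousAt_const hev'
  have ha0 : a = 0 := by simpa [hc0] using hev'
  simp [ha0, hb0, hc0] at hne

lemma tendsto_theta1_sq_mul_weierstrassP {τ : ℂ} (hτ : 0 < τ.im) :
    Tendsto (fun z ↦ theta1 (Real.pi * z) τ ^ 2 * (periodPairOfTau τ hτ).weierstrassP z) (𝓝[≠] 0)
      (𝓝 ((Real.pi * theta1deriv τ) ^ 2)) := by
  have hd := ((differentiable_theta1_pi_mul hτ) 0).hasDerivAt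
  rw [deriv_theta1_pi_mul_zero hτ, hasDerivAt_iff_tendsto_slope_zero] at hd
  have := (hd.pow 2).mul (periodPairOfTau τ hτ).tendsto_sq_mul_weierstrassP
  rw [mul_one] at this
  refine this.congr' ?_
  filter_upwards [self_mem_nhdsWithin] with z hz
  have hz : z ≠ 0 := hz
  simp only [zero_add, mul_zero, theta1_zero, sub_zero, smul_eq_mul]
  field_simp

end

/-- Corollary 1: ℘(z, τ) expressed via θ₁ functions and a zero ±α₁ of ℘. -/
theorem wp_eq_theta (τ : ℂ) (hτ : 0 < τ.im) (α1 : ℂ)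
    (hα1 : ∀ m n : ℤ, α1 ≠ (m : ℂ) + (n : ℂ) * τ)
    (h2α1 : ∀ m n : ℤ, 2 * α1 ≠ (m : ℂ) + (n : ℂ) * τ)
    (hzero : wp 1 τ α1 = 0)
    (z : ℂ) (hz : ∀ m n : ℤ, z ≠ (m : ℂ) + (n : ℂ) * τ) :
    wp 1 τ z =
      -(Real.pi : ℂ) ^ 2 * ((theta1deriv τ) ^ 2 / (theta1 ((Real.pi : ℂ) * α1) τ) ^ 2) *
        (theta1 ((Real.pi : ℂ) * z - (Real.pi : ℂ) * α1) τ *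
          theta1 ((Real.pi : ℂ) * z + (Real.pi : ℂ) * α1) τ) /
        (theta1 ((Real.pi : ℂ) * z) τ) ^ 2 := by
  set L := periodPairOfTau τ hτ with hL
  have hαL : α1 ∉ L.lattice := by
    simpa [hL, mem_lattice_periodPairOfTau hτ] using hα1
  have hzL : z ∉ L.lattice := by
    simpa [hL, mem_lattice_periodPairOfTau hτ] using hz
  have hFα := theta1_pi_mul_ne_zero hτ hαL
  have hFz := theta1_pi_mul_ne_zero hτ hzL
  have hc : (Real.pi : ℂ) * theta1deriv τ ≠ 0 :=
    mul_ne_zero (by exact_mod_cast Real.pi_ne_zero) (theta1deriv_ne_zero hτ)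
  obtain ⟨E, hE, hE'⟩ := exists_isThetaTwo_eq_theta1_sq_mul_weierstrassP hτ (w := 0)
    (by simp [theta1_zero])
  simp only [sub_zero] at hE'
  obtain ⟨a, b, d, hne, hrel⟩ := IsThetaTwo.exists_linear_relation (IsThetaTwo.theta1_sq hτ) hE
    (IsThetaTwo.theta1_mul_theta1 hτ α1)
  rw [wp_eq_weierstrassP hτ] at hzero ⊢
  have hE0 : E 0 = (Real.pi * theta1deriv τ) ^ 2 := by
    refine tendsto_nhds_unique (hE.differentiable.continuous.continuousAt.tendsto.mono_left
      nhdsWithin_le_nhds) ((tendsto_theta1_sq_mul_weierstrassP hτ).congr' ?_)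
    filter_upwards [L.eventually_notMem_lattice] with x hx
    exact (hE' x hx).symm
  have ha : a = 0 := by
    have := hrel α1
    rw [hE' α1 hαL, hzero] at this
    simpa [theta1_zero, hFα] using this
  have h0 : b * (Real.pi * theta1deriv τ) ^ 2 = d * theta1 (Real.pi * α1) τ ^ 2 := by
    have := hrel 0
    rw [hE0, mul_zero, theta1_zero, zero_sub, zero_add, mul_neg, theta1_neg] at this
    linear_combination this
  have hd : d ≠ 0 := by
    rintro rfl
    have hb : b = 0 := by simpa [hc] using h0
    simp [ha, hb] at hne
  have h1 := hrel z
  rw [hE' z hzL, ha, mul_sub, mul_add] at h1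
  rw [eq_div_iff (pow_ne_zero 2 hFz), mul_div_assoc', div_mul_eq_mul_div,
    eq_div_iff (pow_ne_zero 2 hFα)]
  refine mul_left_cancel₀ hd ?_
  linear_combination (Real.pi * theta1deriv τ) ^ 2 * h1 -
    theta1 (Real.pi * z) τ ^ 2 * L.weierstrassP z * h0
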